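/- Boundedness of the Hardy–Littlewood maximal operator on Morrey spaces: for 1 < p < ∞ and 0 < λ ≤ n there is a constant C such that for all f with ‖f‖_{L^{p,λ}(ℝ^n)} < ∞, ‖M f‖_{L^{p,λ}(ℝ^n)} ≤ C ‖f‖_{L^{p,λ}(ℝ^n)}. -/

import Mathlib

open MeasureTheory Metric

/-- Riesz potential `I_α g(x) = ∫ |x-y|^{α-n} g(y) dy` (values in `[0,∞]`). -/
noncomputable def rieszPot (n : ℕ) (α : ℝ) (g : EuclideanSpace ℝ (Fin n) → ENNReal)
    (x : EuclideanSpace ℝ (Fin n)) : ENNReal :=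
  ∫⁻ y, ENNReal.ofReal (‖x - y‖ ^ (α - (n : ℝ))) * g y

/-- Centered Hardy–Littlewood maximal function `M g(x) = sup_{r>0} ⨍_{B_r(x)} g`. -/
noncomputable def maximal (n : ℕ) (g : EuclideanSpace ℝ (Fin n) → ENNReal)
    (x : EuclideanSpace ℝ (Fin n)) : ENNReal :=
  ⨆ (r : ℝ) (_ : 0 < r), (volume (ball x r))⁻¹ * ∫⁻ y in ball x r, g y

/-- `p`-th power of the Morrey norm on `ℝ^n`:
`sup_{x₀, r>0} r^{λ-n} ∫_{B_r(x₀)} g^p` (for `[0,∞]`-valued `g`). -/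
noncomputable def morreyPE (n : ℕ) (p lam : ℝ) (g : EuclideanSpace ℝ (Fin n) → ENNReal) :
    ENNReal :=
  ⨆ (x₀ : EuclideanSpace ℝ (Fin n)) (r : ℝ) (_ : 0 < r),
    ENNReal.ofReal (r ^ (lam - n)) * ∫⁻ x in ball x₀ r, g x ^ p

theorem volume_ball_eq (n : ℕ) (x : EuclideanSpace ℝ (Fin n)) {r : ℝ} (hr : 0 < r) :
    volume (ball x r) =
      ENNReal.ofReal (r ^ n) * volume (ball (0 : EuclideanSpace ℝ (Fin n)) 1) := by
  simpa using Measure.addHaar_ball_of_pos volume x hr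

theorem volume_closedBall_five_mul (n : ℕ) (x : EuclideanSpace ℝ (Fin n)) {r : ℝ} (hr : 0 < r) :
    volume (closedBall x (5 * r)) = 5 ^ n * volume (ball x r) := by
  rw [volume_ball_eq n x hr, Measure.addHaar_closedBall volume x (by positivity),
    finrank_euclideanSpace_fin, mul_pow, ENNReal.ofReal_mul (by positivity), mul_assoc,
    ENNReal.ofReal_pow (by norm_num)]
  norm_num

/-- Weak type `(1,1)` bound for the centered maximal function. -/
theorem mul_volume_lt_maximal_le {n : ℕ} (hn : 0 < n) (g : EuclideanSpace ℝ (Fin n) → ENNReal)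
    {t : ENNReal} (ht : t ≠ 0) (ht' : t ≠ ⊤) :
    t * volume {x | t < maximal n g x} ≤ 5 ^ n * ∫⁻ y, g y := by
  rcases eq_or_ne (∫⁻ y, g y) ⊤ with hI | hI
  · rw [hI, ENNReal.mul_top (by positivity)]
    exact le_top
  have key : ∀ x ∈ {x | t < maximal n g x}, ∃ r : ℝ, 0 < r ∧
      t * volume (ball x r) ≤ ∫⁻ y in ball x r, g y := by
    intro x hx
    simp only [Set.mem_ofPred_eq, maximal, lt_iSup_iff] at hx
    obtain ⟨r, hr, h⟩ := hx
    refine ⟨r, hr, ?_⟩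
    rw [← ENNReal.div_eq_inv_mul] at h
    exact ENNReal.mul_le_of_le_div h.le
  choose! r hr hrt using key
  set v := volume (ball (0 : EuclideanSpace ℝ (Fin n)) 1) with hv
  have hv0 : v ≠ 0 := (measure_ball_pos volume _ one_pos).ne'
  have hvt : v ≠ ⊤ := measure_ball_lt_top.ne
  set K := (∫⁻ y, g y) / (t * v) with hK
  have hKt : K ≠ ⊤ := ENNReal.div_ne_top hI (mul_ne_zero ht hv0)
  have hbound : ∀ x ∈ {x | t < maximal n g x}, r x ≤ max 1 K.toReal := by
    intro x hx
    have h1 : ENNReal.ofReal (r x ^ n) ≤ K := by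
      rw [hK, ENNReal.le_div_iff_mul_le (Or.inl (mul_ne_zero ht hv0))
        (Or.inl (ENNReal.mul_ne_top ht' hvt)), mul_left_comm, ← volume_ball_eq n x (hr x hx)]
      exact (hrt x hx).trans (setLIntegral_le_lintegral _ _)
    rcases le_total (r x) 1 with h | h
    · exact h.trans (le_max_left _ _)
    · exact ((le_self_pow₀ h hn.ne').trans
        ((ENNReal.ofReal_le_iff_le_toReal hKt).1 h1)).trans (le_max_right _ _)
  obtain ⟨u, hut, hdisj, hcov⟩ := Vitali.exists_disjoint_subfamily_covering_enlargement_closedBall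
    {x | t < maximal n g x} id r _ hbound 5 (by norm_num)
  have hdisj' : u.PairwiseDisjoint fun x => ball x (r x) :=
    hdisj.mono fun x => ball_subset_closedBall
  have hcount : u.Countable := hdisj'.countable_of_isOpen (fun _ _ => isOpen_ball)
    fun x hx => nonempty_ball.2 (hr x (hut hx))
  have := hcount.to_subtype
  calc t * volume {x | t < maximal n g x}
      ≤ t * volume (⋃ x ∈ u, closedBall x (5 * r x)) := by
        gcongr
        intro x hx
        obtain ⟨b, hb, hsub⟩ := hcov x hx
        exact Set.mem_biUnion hb (hsub (mem_closedBall_self (hr x hx).le))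
    _ ≤ t * ∑' x : u, volume (closedBall (x : EuclideanSpace ℝ (Fin n)) (5 * r x)) := by
        gcongr
        exact measure_biUnion_le _ hcount _
    _ = 5 ^ n * ∑' x : u, t * volume (ball (x : EuclideanSpace ℝ (Fin n)) (r x)) := by
        rw [← ENNReal.tsum_mul_left, ← ENNReal.tsum_mul_left]
        refine tsum_congr fun x => ?_
        rw [volume_closedBall_five_mul n _ (hr x (hut x.2)), mul_left_comm]
    _ ≤ 5 ^ n * ∑' x : u, ∫⁻ y in ball (x : EuclideanSpace ℝ (Fin n)) (r x), g y := by
        gcongr with x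
        exact hrt x (hut x.2)
    _ = 5 ^ n * ∫⁻ y in ⋃ x ∈ u, ball x (r x), g y := by
        rw [lintegral_biUnion hcount (fun _ _ => measurableSet_ball) hdisj']
    _ ≤ 5 ^ n * ∫⁻ y, g y := by
        gcongr
        exact Measure.restrict_le_self

/-- Truncation: only the large values of `g` contribute to large values of `M g`. -/
theorem maximal_le_maximal_indicator_add (n : ℕ) {g : EuclideanSpace ℝ (Fin n) → ENNReal}
    (hg : Measurable g) (s : ENNReal) (x : EuclideanSpace ℝ (Fin n)) :
    maximal n g x ≤ maximal n ({y | s < g y}.indicator g) x + s := by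
  refine iSup₂_le fun r hr => ?_
  have hmeas : MeasurableSet {y | s < g y} := measurableSet_lt measurable_const hg
  calc (volume (ball x r))⁻¹ * ∫⁻ y in ball x r, g y
      ≤ (volume (ball x r))⁻¹ * ∫⁻ y in ball x r, ({y | s < g y}.indicator g y + s) := by
        gcongr with y
        by_cases h : s < g y
        · rw [Set.indicator_of_mem (by exact h)]
          exact le_self_add
        · exact (not_lt.1 h).trans le_add_self
    _ = (volume (ball x r))⁻¹ * (∫⁻ y in ball x r, {y | s < g y}.indicator g y) + s := by
        rw [lintegral_add_right _ measurable_const, setLIntegral_const, mul_add, mul_left_comm,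
          ENNReal.inv_mul_cancel (measure_ball_pos volume x hr).ne' measure_ball_lt_top.ne, mul_one]
    _ ≤ _ := by
        gcongr
        exact le_iSup₂_of_le r hr le_rfl

/-- Strong type `(p,p)` bound for the centered maximal function. -/
theorem exists_lintegral_maximal_rpow_le {n : ℕ} (hn : 0 < n) {p : ℝ} (hp : 1 < p) :
    ∃ A : ENNReal, A ≠ ⊤ ∧ ∀ F : EuclideanSpace ℝ (Fin n) → ℝ, Measurable F → (∀ x, 0 ≤ F x) →
      ∫⁻ x, maximal n (fun y => ENNReal.ofReal (F y)) x ^ p ≤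
        A * ∫⁻ x, ENNReal.ofReal (F x) ^ p := by
  have hp0 : 0 < p := one_pos.trans hp
  refine ⟨ENNReal.ofReal p * (5 ^ n * 2) * ((ENNReal.ofReal (p - 1))⁻¹ *
    ENNReal.ofReal (2 ^ (p - 1))), ?_, fun F hF hF0 => ?_⟩
  · have : ENNReal.ofReal (p - 1) ≠ 0 := by simpa using hp
    finiteness
  set g : EuclideanSpace ℝ (Fin n) → ENNReal := fun y => ENNReal.ofReal (F y) with hg
  have hgm : Measurable g := hF.ennreal_ofReal
  set μ := (volume : Measure (EuclideanSpace ℝ (Fin n))).withDensity g with hμ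
  have hlayer := lintegral_rpow_eq_lintegral_meas_lt_mul μ (f := fun x => 2 * F x)
    (Filter.Eventually.of_forall fun x => mul_nonneg zero_le_two (hF0 x))
    (hF.const_mul 2).aemeasurable (p := p - 1) (by linarith)
  have hμint : ∫⁻ x, ENNReal.ofReal ((2 * F x) ^ (p - 1)) ∂μ =
      ENNReal.ofReal (2 ^ (p - 1)) * ∫⁻ x, g x ^ p := by
    rw [hμ, lintegral_withDensity_eq_lintegral_mul _ hgm (by fun_prop),
      ← lintegral_const_mul _ (by fun_prop)]
    refine lintegral_congr fun x => ?_
    simp only [Pi.mul_apply, hg]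
    rw [ENNReal.ofReal_rpow_of_nonneg (hF0 x) hp0.le, ← ENNReal.ofReal_mul (hF0 x),
      ← ENNReal.ofReal_mul (by positivity), Real.mul_rpow zero_le_two (hF0 x)]
    congr 1
    have : F x ^ p = F x * F x ^ (p - 1) := by
      rw [mul_comm, ← Real.rpow_add_one' (hF0 x) (by linarith), sub_add_cancel]
    rw [this]; ring
  have hlevel : ∀ t : ℝ, 0 < t →
      volume {x | ENNReal.ofReal t < maximal n g x} * ENNReal.ofReal (t ^ (p - 1)) ≤
        (5 ^ n * 2) * (μ {x | t < 2 * F x} * ENNReal.ofReal (t ^ (p - 1 - 1))) := by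
    intro t ht
    have hs0 : ENNReal.ofReal (t / 2) ≠ 0 := by simpa using ht
    have hset : {y | ENNReal.ofReal (t / 2) < g y} = {x | t < 2 * F x} := by
      ext y
      simp only [hg, Set.mem_ofPred_eq, ENNReal.ofReal_lt_ofReal_iff_of_nonneg (half_pos ht).le]
      rw [div_lt_iff₀' zero_lt_two]
    have hsub : {x | ENNReal.ofReal t < maximal n g x} ⊆
        {x | ENNReal.ofReal (t / 2) <
          maximal n ({y | ENNReal.ofReal (t / 2) < g y}.indicator g) x} := by
      intro x hx
      have h := lt_of_lt_of_le hx
        (maximal_le_maximal_indicator_add n hgm (ENNReal.ofReal (t / 2)) x)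
      have h2 : ENNReal.ofReal t = ENNReal.ofReal (t / 2) + ENNReal.ofReal (t / 2) := by
        rw [← ENNReal.ofReal_add (half_pos ht).le (half_pos ht).le, add_halves]
      rw [h2] at h
      exact lt_of_add_lt_add_right h
    have hw := mul_volume_lt_maximal_le hn
      ({y | ENNReal.ofReal (t / 2) < g y}.indicator g) hs0 ENNReal.ofReal_ne_top
    rw [hset, lintegral_indicator (measurableSet_lt measurable_const (hF.const_mul 2)),
      ← withDensity_apply _ (measurableSet_lt measurable_const (hF.const_mul 2)), ← hμ,
      ← hset] at hw
    have hpow : ENNReal.ofReal (t ^ (p - 1)) =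
        ENNReal.ofReal (t / 2) * (2 * ENNReal.ofReal (t ^ (p - 1 - 1))) := by
      rw [← ENNReal.ofReal_ofNat, ← ENNReal.ofReal_mul zero_le_two,
        ← ENNReal.ofReal_mul (half_pos ht).le]
      congr 1
      rw [Real.rpow_sub_one ht.ne' (p - 1)]
      field_simp
    calc _ ≤ volume {x | ENNReal.ofReal (t / 2) <
          maximal n ({y | ENNReal.ofReal (t / 2) < g y}.indicator g) x} *
            ENNReal.ofReal (t ^ (p - 1)) := by gcongr
      _ = (ENNReal.ofReal (t / 2) * volume {x | ENNReal.ofReal (t / 2) <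
          maximal n ({y | ENNReal.ofReal (t / 2) < g y}.indicator g) x}) *
            (2 * ENNReal.ofReal (t ^ (p - 1 - 1))) := by rw [hpow]; ring
      _ ≤ (5 ^ n * μ {y | ENNReal.ofReal (t / 2) < g y}) *
            (2 * ENNReal.ofReal (t ^ (p - 1 - 1))) := by gcongr
      _ = _ := by rw [hset]; ring
  -- `maximal n g` is tested against simple functions, so its measurability is not needed.
  rw [lintegral_eq_nnreal]
  refine iSup₂_le fun φ hφ => ?_
  have hφp : ∀ x, ENNReal.ofReal (((φ x : ℝ) ^ p⁻¹) ^ p) = φ x := fun x => by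
    rw [Real.rpow_inv_rpow (φ x).coe_nonneg hp0.ne', ENNReal.ofReal_coe_nnreal]
  have hφm : Measurable fun x => (φ x : ℝ) ^ p⁻¹ := by
    have := φ.measurable
    fun_prop
  rw [← SimpleFunc.lintegral_eq_lintegral]
  calc ∫⁻ x, (φ.map ((↑) : NNReal → ENNReal)) x
      = ∫⁻ x, ENNReal.ofReal (((φ x : ℝ) ^ p⁻¹) ^ p) := by simp only [hφp, SimpleFunc.map_apply]
    _ = ENNReal.ofReal p * ∫⁻ t in Set.Ioi 0,
          volume {x | t < (φ x : ℝ) ^ p⁻¹} * ENNReal.ofReal (t ^ (p - 1)) :=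
        lintegral_rpow_eq_lintegral_meas_lt_mul _
          (Filter.Eventually.of_forall fun x => by positivity) hφm.aemeasurable hp0
    _ ≤ ENNReal.ofReal p * ∫⁻ t in Set.Ioi 0,
          (5 ^ n * 2) * (μ {x | t < 2 * F x} * ENNReal.ofReal (t ^ (p - 1 - 1))) := by
        gcongr 1
        refine setLIntegral_mono' measurableSet_Ioi fun t ht => le_trans ?_ (hlevel t ht)
        gcongr 2
        intro x hx
        have h1 : ENNReal.ofReal t < ENNReal.ofReal ((φ x : ℝ) ^ p⁻¹) :=
          (ENNReal.ofReal_lt_ofReal_iff_of_nonneg (le_of_lt ht)).2 hx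
        refine h1.trans_le ?_
        rw [← ENNReal.rpow_le_rpow_iff hp0, ENNReal.ofReal_rpow_of_nonneg (by positivity) hp0.le,
          hφp]
        exact hφ x
    _ = ENNReal.ofReal p * (5 ^ n * 2) *
          ∫⁻ t in Set.Ioi 0, μ {x | t < 2 * F x} * ENNReal.ofReal (t ^ (p - 1 - 1)) := by
        rw [lintegral_const_mul' _ _ (by finiteness), mul_assoc _ (5 ^ n * 2)]
    _ = ENNReal.ofReal p * (5 ^ n * 2) * ((ENNReal.ofReal (p - 1))⁻¹ *
          ∫⁻ x, ENNReal.ofReal ((2 * F x) ^ (p - 1)) ∂μ) := by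
        rw [hlayer, ← mul_assoc (ENNReal.ofReal (p - 1))⁻¹,
          ENNReal.inv_mul_cancel (by simpa using hp) ENNReal.ofReal_ne_top, one_mul]
    _ = _ := by rw [hμint]; ring

/-- Jensen's inequality for averages of a nonnegative function over a set. -/
theorem inv_measure_mul_setLIntegral_le {α : Type*} [MeasurableSpace α] (μ : Measure α)
    {s : Set α} (hs : μ s ≠ 0) (hs' : μ s ≠ ⊤) {p : ℝ} (hp : 1 < p) {g : α → ENNReal}
    (hg : Measurable g) :
    (μ s)⁻¹ * ∫⁻ y in s, g y ∂μ ≤ ((μ s)⁻¹ * ∫⁻ y in s, g y ^ p ∂μ) ^ (1 / p) := by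
  have hpq := Real.HolderConjugate.conjExponent hp
  have h := ENNReal.lintegral_mul_le_Lp_mul_Lq (μ.restrict s) hpq hg.aemeasurable
    (aemeasurable_const (b := (1 : ENNReal)))
  simp only [Pi.mul_apply, mul_one, ENNReal.one_rpow, lintegral_const, one_mul,
    Measure.restrict_apply_univ] at h
  calc _ ≤ (μ s)⁻¹ * ((∫⁻ y in s, g y ^ p ∂μ) ^ (1 / p) * μ s ^ (1 / p.conjExponent)) := by gcongr
    _ = ((μ s)⁻¹ * μ s ^ (1 / p.conjExponent)) * (∫⁻ y in s, g y ^ p ∂μ) ^ (1 / p) := by ring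
    _ = ((μ s)⁻¹) ^ (1 / p) * (∫⁻ y in s, g y ^ p ∂μ) ^ (1 / p) := by
        congr 1
        have h1 : 1 / p.conjExponent = 1 - 1 / p := by
          have := hpq.inv_add_inv_eq_one
          simp only [one_div]; linarith
        rw [h1, ENNReal.rpow_sub _ _ hs hs', ENNReal.rpow_one, ENNReal.inv_rpow,
          ENNReal.div_eq_inv_mul, mul_left_comm, ENNReal.inv_mul_cancel hs hs', mul_one]
    _ = _ := (ENNReal.mul_rpow_of_nonneg _ _ (by positivity)).symm

theorem setLIntegral_rpow_le_morreyPE (n : ℕ) (p lam : ℝ)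
    (g : EuclideanSpace ℝ (Fin n) → ENNReal) (x : EuclideanSpace ℝ (Fin n)) {r : ℝ} (hr : 0 < r) :
    ∫⁻ y in ball x r, g y ^ p ≤ ENNReal.ofReal (r ^ (n - lam)) * morreyPE n p lam g := by
  have h : ENNReal.ofReal (r ^ (lam - n)) * ∫⁻ y in ball x r, g y ^ p ≤ morreyPE n p lam g :=
    le_iSup_of_le x (le_iSup₂_of_le r hr le_rfl)
  calc _ = ENNReal.ofReal (r ^ (n - lam)) *
        (ENNReal.ofReal (r ^ (lam - n)) * ∫⁻ y in ball x r, g y ^ p) := by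
        rw [← mul_assoc, ← ENNReal.ofReal_mul (by positivity), ← Real.rpow_add hr]
        simp
    _ ≤ _ := by gcongr

/-- Averages over balls of radius at least `r` are controlled by the Morrey norm. -/
theorem rpow_average_le_morreyPE (n : ℕ) {p lam : ℝ} (hp : 1 < p) (hlam : 0 < lam)
    {g : EuclideanSpace ℝ (Fin n) → ENNReal} (hg : Measurable g) (x : EuclideanSpace ℝ (Fin n))
    {r s : ℝ} (hr : 0 < r) (hrs : r ≤ s) :
    ((volume (ball x s))⁻¹ * ∫⁻ y in ball x s, g y) ^ p ≤
      (volume (ball (0 : EuclideanSpace ℝ (Fin n)) 1))⁻¹ * ENNReal.ofReal (r ^ (-lam)) *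
        morreyPE n p lam g := by
  have hs := hr.trans_le hrs
  have hp0 : 0 < p := one_pos.trans hp
  calc _ ≤ (((volume (ball x s))⁻¹ * ∫⁻ y in ball x s, g y ^ p) ^ (1 / p)) ^ p := by
        gcongr
        exact inv_measure_mul_setLIntegral_le volume (measure_ball_pos volume x hs).ne'
          measure_ball_lt_top.ne hp hg
    _ = (volume (ball x s))⁻¹ * ∫⁻ y in ball x s, g y ^ p := by
        rw [one_div, ENNReal.rpow_inv_rpow hp0.ne']
    _ ≤ (volume (ball x s))⁻¹ * (ENNReal.ofReal (s ^ (n - lam)) * morreyPE n p lam g) := by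
        gcongr
        exact setLIntegral_rpow_le_morreyPE n p lam g x hs
    _ = (volume (ball (0 : EuclideanSpace ℝ (Fin n)) 1))⁻¹ * ENNReal.ofReal (s ^ (-lam)) *
        morreyPE n p lam g := by
        have : ENNReal.ofReal (s ^ (n - lam)) =
            ENNReal.ofReal (s ^ n) * ENNReal.ofReal (s ^ (-lam)) := by
          rw [← ENNReal.ofReal_mul (by positivity), sub_eq_add_neg, Real.rpow_add hs,
            Real.rpow_natCast]
        have h0 : ENNReal.ofReal (s ^ n) ≠ 0 := by simpa using pow_pos hs n
        rw [volume_ball_eq n x hs, this, ENNReal.mul_inv (Or.inl h0) (Or.inl ENNReal.ofReal_ne_top)]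
        calc _ = ((ENNReal.ofReal (s ^ n))⁻¹ * ENNReal.ofReal (s ^ n)) *
              ((volume (ball (0 : EuclideanSpace ℝ (Fin n)) 1))⁻¹ *
                ENNReal.ofReal (s ^ (-lam)) * morreyPE n p lam g) := by ring
          _ = _ := by rw [ENNReal.inv_mul_cancel h0 ENNReal.ofReal_ne_top, one_mul]
    _ ≤ _ := by
        gcongr _ * ENNReal.ofReal ?_ * _
        exact Real.rpow_le_rpow_of_nonpos hr hrs (neg_nonpos.2 hlam.le)

theorem maximal_rpow_le_of_mem_ball (n : ℕ) {p lam : ℝ} (hp : 1 < p) (hlam : 0 < lam)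
    {g : EuclideanSpace ℝ (Fin n) → ENNReal} (hg : Measurable g)
    {x₀ x : EuclideanSpace ℝ (Fin n)} {r : ℝ} (hr : 0 < r) (hx : x ∈ ball x₀ r) :
    maximal n g x ^ p ≤ maximal n ((ball x₀ (2 * r)).indicator g) x ^ p +
      (volume (ball (0 : EuclideanSpace ℝ (Fin n)) 1))⁻¹ * ENNReal.ofReal (r ^ (-lam)) *
        morreyPE n p lam g := by
  have hp0 : 0 < p := one_pos.trans hp
  rw [← ENNReal.le_rpow_inv_iff hp0]
  refine iSup₂_le fun s hs => ?_
  rw [ENNReal.le_rpow_inv_iff hp0]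
  rcases le_total r s with hrs | hsr
  · exact (rpow_average_le_morreyPE n hp hlam hg x hr hrs).trans le_add_self
  · refine le_trans ?_ le_self_add
    gcongr
    refine le_iSup₂_of_le s hs ?_
    gcongr 1
    refine (setLIntegral_congr_fun measurableSet_ball fun y hy => ?_).le
    have : y ∈ ball x₀ (2 * r) := by
      rw [mem_ball] at hx hy ⊢
      linarith [dist_triangle y x x₀]
    exact (Set.indicator_of_mem this g).symm

/-- Chiarenza–Frasca: the Hardy–Littlewood maximal operator is bounded on the
Morrey space `L^{p,λ}(ℝ^n)` for `1 < p < ∞`, `0 < λ ≤ n`. -/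
theorem stmt12 (n : ℕ) (hn : 0 < n) (p lam : ℝ) (hp : 1 < p) (hlam0 : 0 < lam)
    (hlamn : lam ≤ n) :
    ∃ C : ℝ, 0 < C ∧ ∀ f : EuclideanSpace ℝ (Fin n) → ℝ, Measurable f →
      morreyPE n p lam (fun x => ENNReal.ofReal |f x|) ≠ ⊤ →
      (morreyPE n p lam (maximal n (fun x => ENNReal.ofReal |f x|))) ^ (1 / p) ≤
        ENNReal.ofReal C * (morreyPE n p lam (fun x => ENNReal.ofReal |f x|)) ^ (1 / p) := by
  have hp0 : 0 < p := one_pos.trans hp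
  obtain ⟨A, hA, hstrong⟩ := exists_lintegral_maximal_rpow_le hn hp
  set D : ENNReal := A * ENNReal.ofReal (2 ^ (n - lam)) + 1 with hD
  have hDt : D ≠ ⊤ := by finiteness
  have hDp : D ^ (1 / p) ≠ ⊤ := ENNReal.rpow_ne_top_of_nonneg (by positivity) hDt
  refine ⟨(D ^ (1 / p)).toReal, ENNReal.toReal_pos ?_ hDp, fun f hf _ => ?_⟩
  · have : 0 < D := by positivity
    exact (ENNReal.rpow_pos this hDt).ne'
  rw [ENNReal.ofReal_toReal hDp, ← ENNReal.mul_rpow_of_nonneg _ _ (by positivity)]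
  gcongr
  set g : EuclideanSpace ℝ (Fin n) → ENNReal := fun x => ENNReal.ofReal |f x| with hg
  have hgm : Measurable g := by fun_prop
  set v := volume (ball (0 : EuclideanSpace ℝ (Fin n)) 1) with hv
  have hv0 : v ≠ 0 := (measure_ball_pos volume _ one_pos).ne'
  have hvt : v ≠ ⊤ := measure_ball_lt_top.ne
  refine iSup_le fun x₀ => iSup₂_le fun r hr => ?_
  have hlocal : ∫⁻ x, maximal n ((ball x₀ (2 * r)).indicator g) x ^ p ≤
      A * (ENNReal.ofReal ((2 * r) ^ (n - lam)) * morreyPE n p lam g) := by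
    have h := hstrong ((ball x₀ (2 * r)).indicator fun x => |f x|)
      (Measurable.indicator (by fun_prop) measurableSet_ball)
      (Set.indicator_nonneg fun x _ => abs_nonneg _)
    have hcomp : (fun y => ENNReal.ofReal ((ball x₀ (2 * r)).indicator (fun x => |f x|) y)) =
        (ball x₀ (2 * r)).indicator g :=
      (Set.indicator_comp_of_zero ENNReal.ofReal_zero).symm
    have hpow : (fun y => ENNReal.ofReal ((ball x₀ (2 * r)).indicator (fun x => |f x|) y) ^ p) =
        (ball x₀ (2 * r)).indicator fun y => g y ^ p := by
      ext y
      by_cases hy : y ∈ ball x₀ (2 * r) <;> simp [hy, hp0, hg]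
    rw [hcomp, hpow, lintegral_indicator measurableSet_ball] at h
    refine h.trans ?_
    gcongr
    exact setLIntegral_rpow_le_morreyPE n p lam g x₀ (by positivity)
  calc ENNReal.ofReal (r ^ (lam - n)) * ∫⁻ x in ball x₀ r, maximal n g x ^ p
      ≤ ENNReal.ofReal (r ^ (lam - n)) * ∫⁻ x in ball x₀ r,
          (maximal n ((ball x₀ (2 * r)).indicator g) x ^ p +
            v⁻¹ * ENNReal.ofReal (r ^ (-lam)) * morreyPE n p lam g) := by
        gcongr 1
        exact setLIntegral_mono' measurableSet_ball fun x hx =>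
          maximal_rpow_le_of_mem_ball n hp hlam0 hgm hr hx
    _ = ENNReal.ofReal (r ^ (lam - n)) *
          ((∫⁻ x in ball x₀ r, maximal n ((ball x₀ (2 * r)).indicator g) x ^ p) +
            v⁻¹ * ENNReal.ofReal (r ^ (-lam)) * morreyPE n p lam g *
              (ENNReal.ofReal (r ^ n) * v)) := by
        rw [lintegral_add_right _ measurable_const, setLIntegral_const, volume_ball_eq n x₀ hr]
    _ ≤ ENNReal.ofReal (r ^ (lam - n)) *
          (A * (ENNReal.ofReal ((2 * r) ^ (n - lam)) * morreyPE n p lam g) +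
            v⁻¹ * ENNReal.ofReal (r ^ (-lam)) * morreyPE n p lam g *
              (ENNReal.ofReal (r ^ n) * v)) := by
        gcongr
        exact (setLIntegral_le_lintegral _ _).trans hlocal
    _ = (A * (ENNReal.ofReal (r ^ (lam - n)) * ENNReal.ofReal ((2 * r) ^ (n - lam))) +
          (v⁻¹ * v) * (ENNReal.ofReal (r ^ (lam - n)) * ENNReal.ofReal (r ^ (-lam)) *
            ENNReal.ofReal (r ^ n))) * morreyPE n p lam g := by ring
    _ = D * morreyPE n p lam g := by
        have h1 : r ^ (lam - n) * (2 * r) ^ (n - lam) = 2 ^ (n - lam) := by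
          rw [Real.mul_rpow zero_le_two hr.le, mul_left_comm, ← Real.rpow_add hr]
          simp
        have h2 : r ^ (lam - n) * r ^ (-lam) * r ^ n = 1 := by
          rw [← Real.rpow_natCast, ← Real.rpow_add hr, ← Real.rpow_add hr,
            show lam - n + -lam + n = 0 by ring, Real.rpow_zero]
        rw [ENNReal.inv_mul_cancel hv0 hvt, ← ENNReal.ofReal_mul (by positivity), h1,
          ← ENNReal.ofReal_mul (by positivity), ← ENNReal.ofReal_mul (by positivity), h2,
          ENNReal.ofReal_one, mul_one, hD]
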